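/- arXiv:1803.00972 — 4 statements merged into one kernel-verified Lean document; each statement's English description precedes it below -/
import Mathlib

section
/- For δ > 0, β > 0 and a binary qubit POVM in conical coordinates (w, λ, θ, φ), the Fisher information of the measurement equals F_β = δ² λ² w cos²θ · sech⁴(βδ/2) / (4 Q (1 − w Q)), where Q = 1 − λ cosθ · tanh(βδ/2). -/
open Matrix ComplexOrder Real

noncomputable def pauliX : Matrix (Fin 2) (Fin 2) ℂ := !![0, 1; 1, 0]
noncomputable def pauliY : Matrix (Fin 2) (Fin 2) ℂ := !![0, -Complex.I; Complex.I, 0]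
noncomputable def pauliZ : Matrix (Fin 2) (Fin 2) ℂ := !![1, 0; 0, -1]

/-- The thermal qubit state `ρ_β = diag(e^{−βδ/2}, e^{βδ/2})/(2 cosh(βδ/2))`. -/
noncomputable def rhoTherm (δ β : ℝ) : Matrix (Fin 2) (Fin 2) ℂ :=
  ((2 * Real.cosh (β * δ / 2) : ℝ)⁻¹ : ℂ) •
    !![Complex.exp (-(β * δ / 2)), 0; 0, Complex.exp (β * δ / 2)]

/-- The POVM element `Π₀` of a binary qubit POVM in conical coordinates. -/
noncomputable def povm0 (w l θ φ : ℝ) : Matrix (Fin 2) (Fin 2) ℂ :=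
  (w : ℂ) • ((1 : Matrix (Fin 2) (Fin 2) ℂ)
    + ((l * Real.sin θ * Real.cos φ : ℝ) : ℂ) • pauliX
    + ((l * Real.sin θ * Real.sin φ : ℝ) : ℂ) • pauliY
    + ((l * Real.cos θ : ℝ) : ℂ) • pauliZ)

/-- The POVM element `Π₁ = I₂ − Π₀`. -/
noncomputable def povm1 (w l θ φ : ℝ) : Matrix (Fin 2) (Fin 2) ℂ :=
  1 - povm0 w l θ φ

/-- The outcome probability `p₀(β) = tr(ρ_β Π₀)`. -/
noncomputable def prob0 (δ β w l θ φ : ℝ) : ℝ :=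
  ((rhoTherm δ β * povm0 w l θ φ).trace).re

/-- The Fisher information of the measurement, `F_β = (dp₀/dβ)²/(p₀ p₁)`. -/
noncomputable def fisherInfo (δ β w l θ φ : ℝ) : ℝ :=
  (deriv (fun b => prob0 δ b w l θ φ) β) ^ 2 /
    (prob0 δ β w l θ φ * (1 - prob0 δ β w l θ φ))

lemma prob0_eq (δ β w l θ φ : ℝ) :
    prob0 δ β w l θ φ = w * (1 - l * Real.cos θ * Real.tanh (β * δ / 2)) := by
  have hc : Real.cosh (β * δ / 2) ≠ 0 := (Real.cosh_pos _).ne'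
  have htrace : (rhoTherm δ β * povm0 w l θ φ).trace =
      (((2 * Real.cosh (β * δ / 2))⁻¹ * (Real.exp (-(β * δ / 2)) * (w * (1 + l * Real.cos θ))
        + Real.exp (β * δ / 2) * (w * (1 - l * Real.cos θ))) : ℝ) : ℂ) := by
    simp [rhoTherm, povm0, pauliX, pauliY, pauliZ, Matrix.trace_fin_two, Matrix.one_fin_two]
    ring
  rw [prob0, htrace, Complex.ofReal_re, Real.tanh_eq_sinh_div_cosh, ← Real.cosh_sub_sinh,
    ← Real.cosh_add_sinh]
  field_simp
  ring

lemma hasDerivAt_tanh (x : ℝ) : HasDerivAt Real.tanh (((Real.cosh x)⁻¹) ^ 2) x := by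
  have hc : Real.cosh x ≠ 0 := (Real.cosh_pos x).ne'
  have h := (Real.hasDerivAt_sinh x).div (Real.hasDerivAt_cosh x) hc
  have hfun : Real.tanh = Real.sinh / Real.cosh := funext Real.tanh_eq_sinh_div_cosh
  rw [hfun]
  refine h.congr_deriv ?_
  rw [← sq, ← sq, Real.cosh_sq_sub_sinh_sq, inv_pow, one_div]

lemma hasDerivAt_prob0 (δ β w l θ φ : ℝ) :
    HasDerivAt (fun b => prob0 δ b w l θ φ)
      (-(w * l * Real.cos θ * (δ / 2) * ((Real.cosh (β * δ / 2))⁻¹) ^ 2)) β := by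
  simp only [prob0_eq]
  have hlin : HasDerivAt (fun b : ℝ => b * δ / 2) (δ / 2) β := by
    simpa using ((hasDerivAt_id β).mul_const δ).div_const 2
  have h := ((((hasDerivAt_tanh (β * δ / 2)).comp β hlin).const_mul
    (l * Real.cos θ)).const_sub 1).const_mul w
  refine h.congr_deriv ?_
  ring

/-- Explicit formula for the Fisher information of a binary qubit POVM in
conical coordinates, for the thermal qubit model. -/
theorem stmt2 (δ β w l θ φ : ℝ) (hδ : 0 < δ) (hβ : 0 < β)
    (hw : 0 < w) (hw' : w ≤ 1 / 2) (hl : 0 ≤ l) (hl' : l ≤ 1)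
    (hθ : 0 ≤ θ) (hθ' : θ ≤ π) (hφ : 0 ≤ φ) (hφ' : φ < 2 * π) :
    fisherInfo δ β w l θ φ =
      δ ^ 2 * l ^ 2 * w * Real.cos θ ^ 2 * ((Real.cosh (β * δ / 2))⁻¹) ^ 4 /
        (4 * (1 - l * Real.cos θ * Real.tanh (β * δ / 2)) *
          (1 - w * (1 - l * Real.cos θ * Real.tanh (β * δ / 2)))) := by
  have key (Q : ℝ) :
      (-(w * l * Real.cos θ * (δ / 2) * ((Real.cosh (β * δ / 2))⁻¹) ^ 2)) ^ 2 /
        (w * Q * (1 - w * Q)) =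
      δ ^ 2 * l ^ 2 * w * Real.cos θ ^ 2 * ((Real.cosh (β * δ / 2))⁻¹) ^ 4 /
        (4 * Q * (1 - w * Q)) := by
    rw [← mul_div_mul_left _ (4 * Q * (1 - w * Q)) (div_ne_zero hw.ne' four_ne_zero)]
    congr 1 <;> ring
  rw [fisherInfo, (hasDerivAt_prob0 δ β w l θ φ).deriv, prob0_eq]
  exact key _
end

section
/- For δ > 0, β > 0 and every binary qubit POVM in conical coordinates (w, λ, θ, φ), the F-disturbance satisfies D^{(F)} ≤ 1/2, with equality if and only if the measurement is projective and maximally non-commuting, i.e. w = 1/2, λ = 1 and θ = π/2. -/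
open Real

/-- The F-disturbance of a binary qubit POVM in conical coordinates: the average
squared-fidelity deficit between the pre- and post-measurement states. -/
noncomputable def fDist (δ β w l θ : ℝ) : ℝ :=
  ((1 + Real.cos θ ^ 2 + Real.sin θ ^ 2 * Real.cosh (β * δ)) /
      (2 * (1 + Real.cosh (β * δ)))) *
    (1 - w * Real.sqrt (1 - l ^ 2) - Real.sqrt ((1 - w) ^ 2 - w ^ 2 * l ^ 2))
/-- The F-disturbance is at most `1/2`, with equality iff the measurement is projective
and maximally non-commuting: `w = 1/2`, `λ = 1`, `θ = π/2`. -/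
theorem stmt16 (δ β : ℝ) (hδ : 0 < δ) (hβ : 0 < β) :
    ∀ w l θ φ : ℝ, 0 < w → w ≤ 1 / 2 → 0 ≤ l → l ≤ 1 →
      0 ≤ θ → θ ≤ π → 0 ≤ φ → φ < 2 * π →
      fDist δ β w l θ ≤ 1 / 2 ∧
      (fDist δ β w l θ = 1 / 2 ↔ (w = 1 / 2 ∧ l = 1 ∧ θ = π / 2)) := by
  intro w l θ φ hw hw' hl hl' hθ hθ' _ _
  have hC : 1 < Real.cosh (β * δ) := Real.one_lt_cosh.2 (mul_pos hβ hδ).ne'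
  have hsc := Real.sin_sq_add_cos_sq θ
  have hcos := sq_nonneg (Real.cos θ)
  have hsin := sq_nonneg (Real.sin θ)
  have ha : 0 ≤ w * Real.sqrt (1 - l ^ 2) := by positivity
  have hb : 0 ≤ Real.sqrt ((1 - w) ^ 2 - w ^ 2 * l ^ 2) := Real.sqrt_nonneg _
  unfold fDist
  set C := Real.cosh (β * δ)
  have hpre : (1 + Real.cos θ ^ 2 + Real.sin θ ^ 2 * C) / (2 * (1 + C)) =
      1 / 2 - Real.cos θ ^ 2 * ((C - 1) / (2 * (1 + C))) := by
    have : 1 + C ≠ 0 := by positivity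
    rw [show Real.sin θ ^ 2 = 1 - Real.cos θ ^ 2 by linarith]
    field_simp
    ring
  have hk : 0 < (C - 1) / (2 * (1 + C)) := div_pos (by linarith) (by linarith)
  have hA : 0 < (1 + Real.cos θ ^ 2 + Real.sin θ ^ 2 * C) / (2 * (1 + C)) := by positivity
  rw [hpre] at hA ⊢
  have hck := mul_nonneg hcos hk.le
  have hAab := mul_nonneg hA.le (add_nonneg ha hb)
  refine ⟨by linarith, fun h => ?_, ?_⟩
  · have hcos0 : Real.cos θ = 0 := by
      have : Real.cos θ ^ 2 * ((C - 1) / (2 * (1 + C))) = 0 := by linarith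
      exact pow_eq_zero_iff two_ne_zero |>.1 ((mul_eq_zero.1 this).resolve_right hk.ne')
    have hab : w * Real.sqrt (1 - l ^ 2) + Real.sqrt ((1 - w) ^ 2 - w ^ 2 * l ^ 2) = 0 :=
      (mul_eq_zero.1 (show _ * _ = (0 : ℝ) by linarith)).resolve_left hA.ne'
    have hl1 : l = 1 := by
      have h0 : Real.sqrt (1 - l ^ 2) = 0 :=
        (mul_eq_zero.1 (show w * Real.sqrt (1 - l ^ 2) = 0 by linarith)).resolve_left hw.ne'
      have := Real.sqrt_eq_zero'.1 h0
      nlinarith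
    subst hl1
    have hw1 := Real.sqrt_eq_zero'.1
      (show Real.sqrt ((1 - w) ^ 2 - w ^ 2 * 1 ^ 2) = 0 by linarith)
    refine ⟨by nlinarith, rfl, ?_⟩
    exact Real.injOn_cos ⟨hθ, hθ'⟩ ⟨by positivity, by linarith [Real.pi_pos]⟩
      (by rw [hcos0, Real.cos_pi_div_two])
  · rintro ⟨rfl, rfl, rfl⟩
    norm_num
end

section
/- Fix δ > 0, β > 0 and γ ∈ (1/2, 1]. For every binary qubit POVM in conical coordinates (w, λ, θ, φ) with purity 2(1 + λ²)w² = γ, the F-disturbance satisfies D^{(F)} ≥ (1 − √(2 − 2γ)) / (1 + cosh(βδ)), and equality holds for the semiclassical POVM with w = 1/2, λ = √(2γ − 1) and θ ∈ {0, π}. -/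
open Real

/-- The two square roots in the F-disturbance sum to at most `√(2 - 2γ)`, where
`γ = 2 (1 + l ^ 2) w ^ 2` is the purity. -/
lemma mul_sqrt_add_sqrt_le_sqrt_purity {w l γ : ℝ} (hw : 0 < w) (hw' : w ≤ 1 / 2) (hl : 0 ≤ l)
    (hl' : l ≤ 1) (hγ : γ ≤ 1) (h : 2 * (1 + l ^ 2) * w ^ 2 = γ) :
    w * √(1 - l ^ 2) + √((1 - w) ^ 2 - w ^ 2 * l ^ 2) ≤ √(2 - 2 * γ) := by
  have hl2 : 0 ≤ 1 - l ^ 2 := by nlinarith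
  have hwl : w * l ≤ w := by nlinarith
  have hb : 0 ≤ (1 - w) ^ 2 - w ^ 2 * l ^ 2 := by
    nlinarith [mul_nonneg hw.le hl]
  have ha2 : (w * √(1 - l ^ 2)) ^ 2 = 2 * w ^ 2 - γ / 2 := by
    rw [mul_pow, Real.sq_sqrt hl2]; linarith
  have hb2 : √((1 - w) ^ 2 - w ^ 2 * l ^ 2) ^ 2 = 1 - 2 * w + 2 * w ^ 2 - γ / 2 := by
    rw [Real.sq_sqrt hb]; linarith
  set a := w * √(1 - l ^ 2)
  set b := √((1 - w) ^ 2 - w ^ 2 * l ^ 2)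
  have hu : 0 ≤ 2 * w * (1 - 2 * w) := mul_nonneg (by linarith) (by linarith)
  have hab : 2 * (a * b) ≤ 1 - γ + 2 * w * (1 - 2 * w) := by
    refine abs_le_of_sq_le_sq' ?_ (by linarith) |>.2
    have : (2 * (a * b)) ^ 2 = 4 * (a ^ 2 * b ^ 2) := by ring
    rw [this, ha2, hb2]
    nlinarith [mul_nonneg (sub_nonneg.2 hγ) hu, sq_nonneg (1 - 2 * w)]
  exact Real.le_sqrt_of_sq_le (by nlinarith)

/-- For fixed purity `γ > 1/2`, the F-disturbance is at least
`(1 − √(2−2γ))/(1 + coshβδ)`, with equality for the semiclassical POVM with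
`w = 1/2`, `λ = √(2γ−1)`, `θ ∈ {0, π}`. -/
theorem stmt17 (δ β γ : ℝ) (hδ : 0 < δ) (hβ : 0 < β) (hγ : 1 / 2 < γ) (hγ' : γ ≤ 1) :
    (∀ w l θ φ : ℝ, 0 < w → w ≤ 1 / 2 → 0 ≤ l → l ≤ 1 →
      0 ≤ θ → θ ≤ π → 0 ≤ φ → φ < 2 * π → 2 * (1 + l ^ 2) * w ^ 2 = γ →
      fDist δ β w l θ ≥ (1 - Real.sqrt (2 - 2 * γ)) / (1 + Real.cosh (β * δ)))
    ∧ (∀ θ : ℝ, (θ = 0 ∨ θ = π) →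
      fDist δ β (1 / 2) (Real.sqrt (2 * γ - 1)) θ =
        (1 - Real.sqrt (2 - 2 * γ)) / (1 + Real.cosh (β * δ))) := by
  have hc : 1 ≤ Real.cosh (β * δ) := Real.one_le_cosh _
  have hc0 : 0 < 1 + Real.cosh (β * δ) := by linarith
  constructor
  · intro w l θ φ hw hw' hl hl' _ _ _ _ h
    have hs : √(2 - 2 * γ) ≤ 1 := Real.sqrt_le_one.2 (by linarith)
    have hsum := mul_sqrt_add_sqrt_le_sqrt_purity hw hw' hl hl' hγ' h
    have hpre : 1 / (1 + Real.cosh (β * δ)) ≤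
        (1 + Real.cos θ ^ 2 + Real.sin θ ^ 2 * Real.cosh (β * δ)) /
          (2 * (1 + Real.cosh (β * δ))) := by
      rw [div_le_div_iff₀ hc0 (by positivity)]
      have : 2 ≤ 1 + Real.cos θ ^ 2 + Real.sin θ ^ 2 * Real.cosh (β * δ) := by
        nlinarith [Real.sin_sq_add_cos_sq θ, sq_nonneg (Real.sin θ)]
      nlinarith
    calc (1 - √(2 - 2 * γ)) / (1 + Real.cosh (β * δ))
        = 1 / (1 + Real.cosh (β * δ)) * (1 - √(2 - 2 * γ)) := by ring
      _ ≤ fDist δ β w l θ :=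
        mul_le_mul hpre (by linarith) (by linarith) (le_trans (by positivity) hpre)
  · intro θ hθ
    have hcos : Real.cos θ ^ 2 = 1 := by rcases hθ with rfl | rfl <;> simp
    have hsin : Real.sin θ ^ 2 = 0 := by rcases hθ with rfl | rfl <;> simp
    have hsq : √(2 * γ - 1) ^ 2 = 2 * γ - 1 := Real.sq_sqrt (by linarith)
    have h1 : 1 - (2 * γ - 1) = 2 - 2 * γ := by ring
    have h2 : ((1 : ℝ) - 1 / 2) ^ 2 - (1 / 2) ^ 2 * (2 * γ - 1) =
        (1 / 2) ^ 2 * (2 - 2 * γ) := by ring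
    rw [fDist, hcos, hsin, hsq, h1, h2, Real.sqrt_mul (by positivity),
      Real.sqrt_sq (by norm_num)]
    field_simp
    ring
end

section
/- Let r : ℝ → ℝ³ be a differentiable map with |r(ξ)| < 1, and let ρ_ξ = (I₂ + r₁(ξ)σ_x + r₂(ξ)σ_y + r₃(ξ)σ_z)/2 be the corresponding family of 2×2 density matrices. If L is a Hermitian 2×2 matrix satisfying dρ_ξ/dξ = (ρ_ξ L + L ρ_ξ)/2 at a point ξ, then the quantum Fisher information at ξ equals tr(ρ_ξ L²) = |r'(ξ)|² + (r(ξ)·r'(ξ))² / (1 − |r(ξ)|²), where r' is the derivative of r, · is the Euclidean inner product on ℝ³ and |·| the Euclidean norm. -/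
open Matrix

/-- The qubit state with Bloch vector `r : Fin 3 → ℝ`. -/
noncomputable def blochState (r : Fin 3 → ℝ) : Matrix (Fin 2) (Fin 2) ℂ :=
  ((1 : ℂ) / 2) • ((1 : Matrix (Fin 2) (Fin 2) ℂ)
    + (r 0 : ℂ) • pauliX + (r 1 : ℂ) • pauliY + (r 2 : ℂ) • pauliZ)

/-- Every complex `2 × 2` matrix is a combination of the identity and the Pauli matrices. -/
theorem exists_pauli_decomposition (L : Matrix (Fin 2) (Fin 2) ℂ) :
    ∃ a x y z : ℂ, L = !![a + z, x - Complex.I * y; x + Complex.I * y, a - z] := by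
  refine ⟨(L 0 0 + L 1 1) / 2, (L 0 1 + L 1 0) / 2, Complex.I * (L 0 1 - L 1 0) / 2,
    (L 0 0 - L 1 1) / 2, ?_⟩
  ext i j
  fin_cases i <;> fin_cases j <;> simp <;> ring_nf <;> simp <;> ring

theorem blochState_eq (r : Fin 3 → ℝ) :
    blochState r = !![(1 + (r 2 : ℂ)) / 2, ((r 0 : ℂ) - Complex.I * r 1) / 2;
      ((r 0 : ℂ) + Complex.I * r 1) / 2, (1 - (r 2 : ℂ)) / 2] := by
  ext i j
  fin_cases i <;> fin_cases j <;> simp [blochState, pauliX, pauliY, pauliZ] <;> ring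

theorem hasDerivAt_blochState_apply {r : ℝ → Fin 3 → ℝ} {r' : Fin 3 → ℝ} {ξ : ℝ}
    (h : ∀ i, HasDerivAt (fun t => r t i) (r' i) ξ) (i j : Fin 2) :
    HasDerivAt (fun t => blochState (r t) i j)
      (((1 / 2 : ℂ) • ((r' 0 : ℂ) • pauliX + (r' 1 : ℂ) • pauliY + (r' 2 : ℂ) • pauliZ)) i j)
      ξ := by
  have hc (k : Fin 3) : HasDerivAt (fun t => (r t k : ℂ)) (r' k : ℂ) ξ := (h k).ofReal_comp
  have hsum := (((((hc 0).mul_const (pauliX i j)).const_add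
    ((1 : Matrix (Fin 2) (Fin 2) ℂ) i j)).add ((hc 1).mul_const (pauliY i j))).add
      ((hc 2).mul_const (pauliZ i j))).const_mul (1 / 2 : ℂ)
  exact hsum

/-- Quantum Fisher information of a qubit statistical model in terms of its Bloch
vector `r(ξ)`: if `|r(ξ)| < 1` and `L` is an SLD at `ξ`, then
`tr(ρ_ξ L²) = |r'(ξ)|² + (r(ξ)·r'(ξ))²/(1 − |r(ξ)|²)`. -/
theorem stmt19 (r : ℝ → Fin 3 → ℝ) (r' : Fin 3 → ℝ) (ξ : ℝ)
    (hderiv : ∀ i, HasDerivAt (fun t => r t i) (r' i) ξ)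
    (hr : ∑ i, (r ξ i) ^ 2 < 1)
    (L : Matrix (Fin 2) (Fin 2) ℂ) (hL : L.IsHermitian)
    (hSLD : ∀ i j : Fin 2, HasDerivAt (fun t : ℝ => blochState (r t) i j)
      ((((1 : ℂ) / 2) • (blochState (r ξ) * L + L * blochState (r ξ))) i j) ξ) :
    (blochState (r ξ) * L ^ 2).trace =
      (((∑ i, (r' i) ^ 2) +
        (∑ i, r ξ i * r' i) ^ 2 / (1 - ∑ i, (r ξ i) ^ 2) : ℝ) : ℂ) := by
  obtain ⟨a, x, y, z, rfl⟩ := exists_pauli_decomposition L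
  have hent (i j : Fin 2) := (hasDerivAt_blochState_apply hderiv i j).unique (hSLD i j)
  have h00 := hent 0 0
  have h01 := hent 0 1
  have h10 := hent 1 0
  have h11 := hent 1 1
  have hI : Complex.I ^ 2 = -1 := Complex.I_sq
  simp [blochState_eq, pauliX, pauliY, pauliZ] at h00 h01 h10 h11
  have hne : (1 : ℂ) - ((r ξ 0 : ℂ) ^ 2 + (r ξ 1 : ℂ) ^ 2 + (r ξ 2 : ℂ) ^ 2) ≠ 0 := by
    rw [Fin.sum_univ_three] at hr
    exact_mod_cast (sub_pos.2 hr).ne'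
  have ha : a = -(r ξ 0 * x + r ξ 1 * y + r ξ 2 * z) := by
    linear_combination -(h00 / 2 + h11) + r ξ 1 * y * hI
  have hx : (r' 0 : ℂ) = x + a * r ξ 0 := by
    linear_combination (h01 + h10) / 2
  have hy : (r' 1 : ℂ) = y + a * r ξ 1 := by
    linear_combination Complex.I * (h01 - h10) / 2 + (r' 1 - y - a * r ξ 1) * hI
  have hz : (r' 2 : ℂ) = z + a * r ξ 2 := by
    linear_combination h00 / 2 - h11
  have hdot : (r ξ 0 : ℂ) * r' 0 + r ξ 1 * r' 1 + r ξ 2 * r' 2 =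
      -a * (1 - ((r ξ 0 : ℂ) ^ 2 + (r ξ 1 : ℂ) ^ 2 + (r ξ 2 : ℂ) ^ 2)) := by
    rw [hx, hy, hz]
    linear_combination ha
  push_cast [Fin.sum_univ_three]
  rw [hdot, mul_pow, pow_two (1 - _ : ℂ), ← mul_assoc, mul_div_assoc,
    div_self hne, mul_one, hx, hy, hz]
  simp [blochState_eq, pow_two, Matrix.trace_fin_two]
  linear_combination -(2 * a * y * r ξ 1 + y ^ 2) * hI
end
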